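/- arXiv:1901.02870 — 4 statements merged into one kernel-verified Lean document; each statement's English description precedes it below -/
import Mathlib

section
/- Let k be an algebraically closed field and V a finite-dimensional k-vector space. For g ∈ GL(V), the commutant {x ∈ End_k(V) : x ∘ g = g ∘ x} has k-dimension equal to dim_k V if and only if for every c ∈ k the eigenspace ker(g − c·id) has dimension at most one (i.e., each eigenspace of g is one-dimensional). -/
open Polynomial

theorem aux_ker_comp {k V : Type*} [Field k] [AddCommGroup V] [Module k V]
    [FiniteDimensional k V] (A B : Module.End k V) :
    Module.finrank k (LinearMap.ker (A * B)) ≤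
      Module.finrank k (LinearMap.ker A) + Module.finrank k (LinearMap.ker B) := by
  let f : LinearMap.ker (A * B) →ₗ[k] LinearMap.ker A :=
    B.restrict (p := LinearMap.ker (A * B)) (q := LinearMap.ker A) (fun x hx => by
      simpa using hx)
  have h := f.finrank_range_add_finrank_ker
  have h1 : Module.finrank k (LinearMap.range f) ≤ Module.finrank k (LinearMap.ker A) :=
    Submodule.finrank_le _
  let j : LinearMap.ker f →ₗ[k] LinearMap.ker B :=
    LinearMap.codRestrict _ ((LinearMap.ker (A * B)).subtype ∘ₗ (LinearMap.ker f).subtype)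
      (fun x => by
        have : f x.1 = 0 := x.2
        exact congrArg Subtype.val this)
  have hj : Function.Injective j := by
    intro x y hxy
    have := congrArg Subtype.val hxy
    exact Subtype.ext (Subtype.ext this)
  have h2 := LinearMap.finrank_le_finrank_of_injective hj
  omega

theorem aux_ker_aeval {k V : Type*} [Field k] [IsAlgClosed k] [AddCommGroup V] [Module k V]
    [FiniteDimensional k V] (T : Module.End k V)
    (h : ∀ c : k, Module.finrank k
        (LinearMap.ker (T - c • (1 : Module.End k V))) ≤ 1) (n : ℕ) :
    ∀ p : k[X], p ≠ 0 → p.natDegree = n →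
      Module.finrank k (LinearMap.ker (aeval T p)) ≤ n := by
  induction n with
  | zero =>
    intro p hp hd
    obtain ⟨a, rfl⟩ := natDegree_eq_zero.mp hd
    have ha : a ≠ 0 := by rintro rfl; simp at hp
    have : LinearMap.ker (aeval T (C a)) = ⊥ := by
      rw [LinearMap.ker_eq_bot']
      intro m hm
      simpa [Module.algebraMap_end_apply, ha] using hm
    rw [this]; simp
  | succ n ih =>
    intro p hp hd
    have hdeg : p.degree ≠ 0 := by
      intro h0
      have := natDegree_eq_of_degree_eq_some (n := 0) (by simpa using h0)
      omega
    obtain ⟨c, hc⟩ := IsAlgClosed.exists_root p hdeg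
    obtain ⟨s, rfl⟩ := dvd_iff_isRoot.mpr hc
    have hs : s ≠ 0 := by rintro rfl; simp at hp
    have hsd : s.natDegree = n := by
      rw [natDegree_mul (X_sub_C_ne_zero c) hs, natDegree_X_sub_C] at hd
      omega
    have h1 := ih s hs hsd
    have h2 := h c
    rw [map_mul]
    have h3 := aux_ker_comp (aeval T (X - C c)) (aeval T s)
    have h4 : aeval T (X - C c) = T - c • (1 : Module.End k V) := by
      simp [Algebra.algebraMap_eq_smul_one]
    rw [h4] at h3 ⊢
    omega

section
variable {k N : Type*} [Field k] [AddCommGroup N] [Module k N] [Module k[X] N]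
  [IsScalarTower k k[X] N] [FiniteDimensional k N]

/-- evaluation at one -/
noncomputable def auxEv (q : k[X]) : ((k[X] ⧸ Ideal.span {q}) →ₗ[k[X]] N) →ₗ[k] N where
  toFun f := f 1
  map_add' _ _ := rfl
  map_smul' _ _ := rfl

theorem auxEv_inj (q : k[X]) : Function.Injective (auxEv (k := k) (N := N) q) := by
  intro f g h
  ext
  exact h

instance auxFin (q : k[X]) : FiniteDimensional k ((k[X] ⧸ Ideal.span {q}) →ₗ[k[X]] N) :=
  Module.Finite.of_injective _ (auxEv_inj q)

/-- multiplication -/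
noncomputable def auxMul (q : k[X]) (i : (k[X] ⧸ Ideal.span {q}) →ₗ[k[X]] N) :
    (k[X] ⧸ Ideal.span {q}) →ₗ[k] ((k[X] ⧸ Ideal.span {q}) →ₗ[k[X]] N) where
  toFun m := i ∘ₗ LinearMap.mulLeft k[X] m
  map_add' a b := by ext; simp
  map_smul' a b := by
    ext
    simp only [LinearMap.comp_apply, RingHom.id_apply, LinearMap.smul_apply]
    rw [← LinearMap.map_smul_of_tower]
    simp

theorem auxMul_inj (q : k[X]) (i : (k[X] ⧸ Ideal.span {q}) →ₗ[k[X]] N)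
    (hi : Function.Injective i) : Function.Injective (auxMul q i) := by
  intro a b h
  have := LinearMap.congr_fun h 1
  simpa [auxMul, hi.eq_iff] using this

theorem aux_le (q : k[X]) (i : (k[X] ⧸ Ideal.span {q}) →ₗ[k[X]] N)
    (hi : Function.Injective i) :
    Module.finrank k (k[X] ⧸ Ideal.span {q}) ≤
      Module.finrank k ((k[X] ⧸ Ideal.span {q}) →ₗ[k[X]] N) :=
  LinearMap.finrank_le_finrank_of_injective (auxMul_inj q i hi)

/-- in the equality case, every `q`-torsion element is in the image of `i` -/
theorem aux_eq (q : k[X]) (i : (k[X] ⧸ Ideal.span {q}) →ₗ[k[X]] N)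
    (hi : Function.Injective i)
    (h : Module.finrank k (k[X] ⧸ Ideal.span {q}) =
      Module.finrank k ((k[X] ⧸ Ideal.span {q}) →ₗ[k[X]] N)) (w : N) (hw : q • w = 0) :
    ∃ m, i m = w := by
  haveI : FiniteDimensional k (k[X] ⧸ Ideal.span {q}) :=
    Module.Finite.of_injective _ (auxMul_inj q i hi)
  have hs := (LinearMap.injective_iff_surjective_of_finrank_eq_finrank h).mp (auxMul_inj q i hi)
  let f : (k[X] ⧸ Ideal.span {q}) →ₗ[k[X]] N :=
    Submodule.liftQ _ (LinearMap.toSpanSingleton k[X] N w) (by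
      rw [Ideal.span, Submodule.span_le]
      simpa using hw)
  obtain ⟨m, hm⟩ := hs f
  refine ⟨m, ?_⟩
  have h1 := LinearMap.congr_fun hm 1
  have h2 : f 1 = w := by
    have : f (Submodule.Quotient.mk 1) = w := by
      simp only [f, Submodule.liftQ_apply]; simp
    exact this
  rw [h2] at h1
  simpa [auxMul] using h1

theorem aux_main {ι : Type*} [Fintype ι] (q : ι → k[X])
    (E : N ≃ₗ[k[X]] (Π i, k[X] ⧸ Ideal.span {q i})) :
    Module.finrank k (N →ₗ[k[X]] N) =
      ∑ i, Module.finrank k ((k[X] ⧸ Ideal.span {q i}) →ₗ[k[X]] N) := by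
  classical
  have e1 : (N →ₗ[k[X]] N) ≃ₗ[k] ((Π i, k[X] ⧸ Ideal.span {q i}) →ₗ[k[X]] N) :=
    { toFun := fun f => f ∘ₗ E.symm.toLinearMap
      invFun := fun f => f ∘ₗ E.toLinearMap
      map_add' := fun _ _ => rfl
      map_smul' := fun _ _ => rfl
      left_inv := fun f => by ext; simp
      right_inv := fun f => by apply LinearMap.ext; simp }
  rw [e1.finrank_eq,
    ← (LinearMap.lsum k[X] (fun i => k[X] ⧸ Ideal.span {q i}) k (M := N)).finrank_eq,
    Module.finrank_pi_fintype]

theorem aux_sum {ι : Type*} [Fintype ι] (q : ι → k[X])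
    (E : N ≃ₗ[k[X]] (Π i, k[X] ⧸ Ideal.span {q i})) :
    Module.finrank k N = ∑ i, Module.finrank k (k[X] ⧸ Ideal.span {q i}) := by
  classical
  haveI : ∀ i, FiniteDimensional k (k[X] ⧸ Ideal.span {q i}) := fun i =>
    Module.Finite.of_surjective
      (((LinearMap.proj i).comp E.toLinearMap : N →ₗ[k[X]] _).restrictScalars k)
      (by
        have := (Function.surjective_eval (α := ι)
          (β := fun i => k[X] ⧸ Ideal.span {q i}) i).comp E.surjective
        exact this)
  rw [(E.restrictScalars k).finrank_eq, Module.finrank_pi_fintype]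

/-- eigenvectors inside a cyclic module -/
theorem aux_cyc (q : k[X]) (hq : q ≠ 0) (c : k) (s : k[X]) (hs : q = (X - C c) * s)
    (m : k[X] ⧸ Ideal.span {q}) (hm : (X - C c) • m = 0) :
    ∃ a : k, a • (Ideal.Quotient.mk (Ideal.span {q}) s) = m := by
  obtain ⟨r, rfl⟩ := Ideal.Quotient.mk_surjective m
  have h1 : Ideal.Quotient.mk (Ideal.span {q}) ((X - C c) * r) = 0 := hm
  rw [Ideal.Quotient.eq_zero_iff_mem, Ideal.mem_span_singleton, hs] at h1
  obtain ⟨t, rfl⟩ := (mul_dvd_mul_iff_left (X_sub_C_ne_zero c)).mp h1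
  refine ⟨t.eval c, ?_⟩
  have h2 : (t.eval c) • (Ideal.Quotient.mk (Ideal.span {q}) s) =
      Ideal.Quotient.mk (Ideal.span {q}) (C (t.eval c) * s) := by
    rw [← smul_eq_C_mul]; rfl
  rw [h2, Ideal.Quotient.eq, Ideal.mem_span_singleton, hs]
  obtain ⟨u, hu⟩ := X_sub_C_dvd_sub_C_eval (p := t) (a := c)
  refine ⟨-u, ?_⟩
  linear_combination (-s) * hu

theorem aux_dvd (q : k[X]) (c : k) (m : k[X] ⧸ Ideal.span {q}) (hm : (X - C c) • m = 0)
    (hm0 : m ≠ 0) : (X - C c) ∣ q := by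
  by_contra hd
  obtain ⟨a, b, hab⟩ := ((irreducible_X_sub_C c).coprime_iff_not_dvd).mpr hd
  obtain ⟨r, rfl⟩ := Ideal.Quotient.mk_surjective m
  have h1 : Ideal.Quotient.mk (Ideal.span {q}) ((X - C c) * r) = 0 := hm
  rw [Ideal.Quotient.eq_zero_iff_mem, Ideal.mem_span_singleton] at h1
  apply hm0
  rw [Ideal.Quotient.eq_zero_iff_mem, Ideal.mem_span_singleton]
  obtain ⟨u, hu⟩ := h1
  exact ⟨a * u + b * r, by linear_combination a * hu - r * hab⟩

end

/-- commutant as module endomorphisms -/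
theorem aux_cent {k V : Type*} [Field k] [AddCommGroup V] [Module k V] (T : Module.End k V) :
    Module.finrank k (Subalgebra.centralizer k ({T} : Set (Module.End k V))) =
      Module.finrank k (Module.AEval' T →ₗ[k[X]] Module.AEval' T) := by
  let o := Module.AEval'.of T
  have e : (Subalgebra.centralizer k ({T} : Set (Module.End k V))) ≃ₗ[k]
      (Module.AEval' T →ₗ[k[X]] Module.AEval' T) :=
    { toFun := fun f => LinearMap.ofAEval T (o.toLinearMap ∘ₗ f.1) (fun m => by
        have h := (Subalgebra.mem_centralizer_iff k).mp f.2 T rfl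
        have h' := LinearMap.congr_fun h m
        simp only [LinearMap.comp_apply]
        erw [Module.AEval'.X_smul_of]
        exact congrArg o h'.symm)
      invFun := fun f => ⟨o.symm.toLinearMap ∘ₗ f.restrictScalars k ∘ₗ o.toLinearMap, by
        rw [Subalgebra.mem_centralizer_iff]
        rintro T' hT'
        rw [Set.mem_singleton_iff] at hT'
        rw [hT']
        ext m
        have h := f.map_smul X (o m)
        have h2 : (X : k[X]) • o m = o (T m) := Module.AEval'.X_smul_of T m
        rw [h2] at h
        have h3 := congrArg o.symm h
        have h4 := Module.AEval'.of_symm_X_smul T (f (o m))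
        exact (h3.trans h4).symm⟩
      map_add' := fun _ _ => rfl
      map_smul' := fun _ _ => rfl
      left_inv := fun f => rfl
      right_inv := fun f => rfl }
  exact e.finrank_eq

/-- Over an algebraically closed field `k`, for `g ∈ GL(V)` with
`V` finite dimensional, the commutant `{x ∈ End_k(V) : x ∘ g = g ∘ x}` has
`k`-dimension `dim V` if and only if every eigenspace `ker (g - c·id)` of `g`
has dimension at most one. -/
theorem stmt2 {k V : Type*} [Field k] [IsAlgClosed k] [AddCommGroup V] [Module k V]
    [FiniteDimensional k V] (g : V ≃ₗ[k] V) :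
    Module.finrank k (Subalgebra.centralizer k ({(g : Module.End k V)} : Set (Module.End k V))) =
        Module.finrank k V ↔
      ∀ c : k, Module.finrank k
        (LinearMap.ker ((g : Module.End k V) - c • (1 : Module.End k V))) ≤ 1 := by
  classical
  generalize (g : Module.End k V) = T
  rw [aux_cent]
  have hT : Module.IsTorsion k[X] (Module.AEval' T) :=
    Module.AEval.isTorsion_of_finiteDimensional k V T
  obtain ⟨ι, _, p, hp, e, ⟨E0⟩⟩ := Module.equiv_directSum_of_isTorsion hT
  have hq : ∀ i, p i ^ e i ≠ 0 := fun i => pow_ne_zero _ (hp i).ne_zero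
  generalize hqq : (fun i => p i ^ e i) = q at *
  have hq : ∀ i, q i ≠ 0 := by subst hqq; exact hq
  have E : Module.AEval' T ≃ₗ[k[X]] (Π i, k[X] ⧸ Ideal.span {q i}) := by
    subst hqq
    exact E0.trans (DirectSum.linearEquivFunOnFintype _ _ _)
  clear E0
  let o := Module.AEval'.of T
  have hV : Module.finrank k V = Module.finrank k (Module.AEval' T) := o.finrank_eq
  rw [hV, aux_main q E, aux_sum q E]
  let i (j : ι) : (k[X] ⧸ Ideal.span {q j}) →ₗ[k[X]] Module.AEval' T :=
    E.symm.toLinearMap ∘ₗ LinearMap.single k[X] (fun i => k[X] ⧸ Ideal.span {q i}) j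
  have hi : ∀ j, Function.Injective (i j) := by
    intro j a b hab
    have h1 := E.symm.injective hab
    exact Pi.single_injective (M := fun i => k[X] ⧸ Ideal.span {q i}) j h1
  have hle := fun j => aux_le (q j) (i j) (hi j)
  have hX : ∀ (c : k) (v : V), v ∈ LinearMap.ker (T - c • (1 : Module.End k V)) →
      (X - C c) • o v = 0 := by
    intro c v hv
    have h4 : aeval T (X - C c) = T - c • (1 : Module.End k V) := by
      simp [Algebra.algebraMap_eq_smul_one]
    have h5 : o (aeval T (X - C c) • v) = (X - C c) • o v :=
      Module.AEval.of_aeval_smul T (X - C c) v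
    rw [← h5, h4]
    have : (T - c • (1 : Module.End k V)) v = 0 := hv
    rw [Module.End.smul_def, this, map_zero]
  constructor
  · intro h c
    have heq := (Finset.sum_eq_sum_iff_of_le (fun j _ => hle j)).mp h.symm
    by_cases hb : LinearMap.ker (T - c • (1 : Module.End k V)) = ⊥
    · rw [hb]; simp
    obtain ⟨v, hv, hv0⟩ := Submodule.exists_mem_ne_zero_of_ne_bot hb
    have hEv : E (o v) ≠ 0 := by simpa using hv0
    obtain ⟨j, hj⟩ := Function.ne_iff.mp hEv
    have hd : (X - C c) ∣ q j := by
      refine aux_dvd (q j) c (E (o v) j) ?_ hj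
      have := congrFun (congrArg E (hX c v hv)) j
      rwa [map_smul, map_zero] at this
    obtain ⟨s, hs⟩ := hd
    have hmem : ∀ w ∈ LinearMap.ker (T - c • (1 : Module.End k V)),
        ∃ a : k, a • o.symm (i j (Ideal.Quotient.mk (Ideal.span {q j}) s)) = w := by
      intro w hw
      have hw' := hX c w hw
      obtain ⟨m, hm⟩ := aux_eq (q j) (i j) (hi j) (heq j (Finset.mem_univ j)) (o w) (by
        rw [hs, mul_comm, mul_smul, hw', smul_zero])
      obtain ⟨a, ha⟩ := aux_cyc (q j) (hq j) c s hs m (by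
        apply hi j
        rw [map_smul, hm, hw', map_zero])
      refine ⟨a, ?_⟩
      rw [← map_smul, ← LinearMap.map_smul_of_tower, ha, hm, LinearEquiv.symm_apply_apply]
    have hsub : LinearMap.ker (T - c • (1 : Module.End k V)) ≤
        Submodule.span k {o.symm (i j (Ideal.Quotient.mk (Ideal.span {q j}) s))} := by
      intro w hw
      exact Submodule.mem_span_singleton.mpr (hmem w hw)
    exact (Submodule.finrank_mono hsub).trans (by
      simpa using finrank_span_le_card (R := k)
        ({o.symm (i j (Ideal.Quotient.mk (Ideal.span {q j}) s))} : Set V))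
  · intro h
    refine Finset.sum_congr rfl (fun j _ => le_antisymm ?_ (hle j))
    rw [finrank_quotient_span_eq_natDegree]
    refine le_trans ?_ (aux_ker_aeval T h _ (q j) (hq j) rfl)
    let f : ((k[X] ⧸ Ideal.span {q j}) →ₗ[k[X]] Module.AEval' T) →ₗ[k]
        LinearMap.ker (aeval T (q j)) :=
      LinearMap.codRestrict _ (o.symm.toLinearMap ∘ₗ auxEv (q j)) (fun x => by
        have h1 : (q j) • x 1 = 0 := by
          rw [← map_smul]
          have : (q j) • (1 : k[X] ⧸ Ideal.span {q j}) = 0 := by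
            have h2 : Ideal.Quotient.mk (Ideal.span {q j}) (q j * 1) = 0 := by
              rw [Ideal.Quotient.eq_zero_iff_mem, mul_one]
              exact Ideal.mem_span_singleton_self _
            exact h2
          rw [this, map_zero]
        have h3 := Module.AEval.of_symm_smul T (q j) (x 1)
        rw [h1, map_zero] at h3
        exact h3.symm)
    refine LinearMap.finrank_le_finrank_of_injective (f := f) ?_
    intro a b hab
    exact auxEv_inj (q j) (o.symm.injective (congrArg Subtype.val hab))
end

section
/- Fix an odd prime power q. Let V be a finite-dimensional F_q-vector space with a nondegenerate symmetric bilinear form B, and let g be an isometry of (V, B) whose minimal polynomial equals its characteristic polynomial f_g ∈ F_q[λ]. Let U ∈ F_q[λ] be monic such that U·U* divides f_g in F_q[λ]. Then ker U(g) is a g-stable totally isotropic subspace of V of dimension equal to deg U, and it equals the image (S·U*)(g)(V) where S := f_g/(U·U*). -/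
/-- The reciprocal polynomial `f*(λ) = f(0)⁻¹ · λ^(deg f) · f(1/λ)` of a
polynomial `f` over a field. -/
noncomputable def recip {F : Type*} [Field F] (f : Polynomial F) : Polynomial F :=
  Polynomial.C (f.coeff 0)⁻¹ * f.reverse

open Polynomial in
theorem aux_finrank {F V : Type*} [Field F] [AddCommGroup V] [Module F V] [FiniteDimensional F V]
    (g : Module.End F V) (f P Q : F[X]) (hf : minpoly F g = f) (hPQ : f = P * Q) :
    P.natDegree ≤ Module.finrank F (LinearMap.range (aeval g Q)) := by
  have hf0 : f ≠ 0 := hf ▸ minpoly.ne_zero (Algebra.IsIntegral.isIntegral g)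
  have hQ0 : Q ≠ 0 := by rintro rfl; simp at hPQ; exact hf0 hPQ
  have hcomm : ∀ (p q : F[X]) (v : V), aeval g p (aeval g q v) = aeval g q (aeval g p v) := by
    intro p q v
    rw [← Module.End.mul_apply, ← Module.End.mul_apply, ← map_mul, ← map_mul, mul_comm]
  have hst : ∀ x ∈ LinearMap.range (aeval g Q), g x ∈ LinearMap.range (aeval g Q) := by
    rintro _ ⟨v, rfl⟩
    refine ⟨g v, ?_⟩
    simpa using (hcomm X Q v).symm
  set r := g.restrict hst with hr
  have hpow : ∀ (p : F[X]) (w : LinearMap.range (aeval g Q)),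
      ((aeval r p w : LinearMap.range (aeval g Q)) : V) = aeval g p (w : V) := by
    intro p
    induction p using Polynomial.induction_on' with
    | add p q hp hq => intro w; simp [hp, hq]
    | monomial n a =>
      intro w
      have : ∀ n : ℕ, (((r ^ n) w : LinearMap.range (aeval g Q)) : V) = (g ^ n) (w : V) := by
        intro n
        induction n with
        | zero => simp
        | succ n ih => rw [pow_succ', pow_succ', Module.End.mul_apply, Module.End.mul_apply, ← ih]; rfl
      simp [aeval_monomial, this, Module.algebraMap_end_apply]
  have hz : aeval g (r.charpoly * Q) = 0 := by
    ext v
    have h1 := hpow r.charpoly ⟨aeval g Q v, v, rfl⟩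
    rw [LinearMap.aeval_self_charpoly] at h1
    simpa using h1.symm
  have hd := minpoly.dvd F g hz
  rw [hf, hPQ] at hd
  have hd2 := (mul_dvd_mul_iff_right hQ0).1 hd
  have := natDegree_le_of_dvd hd2 (LinearMap.charpoly_monic r).ne_zero
  rwa [LinearMap.charpoly_natDegree] at this

open Polynomial in
theorem aux_ker {F V : Type*} [Field F] [AddCommGroup V] [Module F V] [FiniteDimensional F V]
    (g : Module.End F V) (f P Q : F[X]) (hf : minpoly F g = f) (hc : f = g.charpoly)
    (hPQ : f = P * Q) :
    Module.finrank F (LinearMap.ker (aeval g P)) = P.natDegree ∧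
    LinearMap.ker (aeval g P) = LinearMap.range (aeval g Q) := by
  have hf0 : f ≠ 0 := hf ▸ minpoly.ne_zero (Algebra.IsIntegral.isIntegral g)
  have hQ0 : Q ≠ 0 := by rintro rfl; simp at hPQ; exact hf0 hPQ
  have hP0 : P ≠ 0 := by rintro rfl; simp at hPQ; exact hf0 hPQ
  have h1 := aux_finrank g f P Q hf hPQ
  have h2 := aux_finrank g f Q P hf (by rw [hPQ, mul_comm])
  have h3 := LinearMap.finrank_range_add_finrank_ker (aeval g P)
  have h4 : f.natDegree = Module.finrank F V := by rw [hc, LinearMap.charpoly_natDegree]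
  rw [hPQ, natDegree_mul hP0 hQ0] at h4
  have hle : LinearMap.range (aeval g Q) ≤ LinearMap.ker (aeval g P) := by
    rintro _ ⟨v, rfl⟩
    rw [LinearMap.mem_ker, ← Module.End.mul_apply, ← map_mul, ← hPQ, ← hf, minpoly.aeval]
    rfl
  have h5 := Submodule.finrank_mono hle
  refine ⟨by omega, (Submodule.eq_of_le_of_finrank_eq hle (by omega)).symm⟩

open Polynomial in
theorem aux_adj {F V : Type*} [Field F] [AddCommGroup V] [Module F V]
    (B : LinearMap.BilinForm F V) (g : Module.End F V) (hg : ∀ x y : V, B (g x) (g y) = B x y)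
    (z y : V) (N : ℕ) (p : F[X]) (hp : p.natDegree ≤ N) :
    B (aeval g (reflect N p) z) ((g ^ N) y) = B z (aeval g p y) := by
  have hgn : ∀ (n : ℕ) (x y : V), B ((g ^ n) x) ((g ^ n) y) = B x y := by
    intro n
    induction n with
    | zero => simp
    | succ n ih => intro x y; rw [pow_succ', Module.End.mul_apply, Module.End.mul_apply, hg, ih]
  refine Polynomial.induction_with_natDegree_le
    (motive := fun p => B (aeval g (reflect N p) z) ((g ^ N) y) = B z (aeval g p y)) N
    ?_ ?_ ?_ p hp
  · simp
  · intro n r hr hn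
    rw [reflect_C_mul_X_pow, revAt_le hn]
    obtain ⟨k, rfl⟩ := Nat.exists_eq_add_of_le' hn
    simp [Module.algebraMap_end_apply, pow_add g k n, hgn]
  · intro p q hpq hq ihp ihq
    simp [reflect_add, ihp, ihq]

/-- Let `V` be a finite-dimensional space over `F_q` (`q` odd)
with a nondegenerate symmetric bilinear form `B`, and `g` an isometry whose
minimal polynomial equals its characteristic polynomial `f_g`.  If `U` is monic
with `U·U* ∣ f_g`, then `ker U(g)` is a `g`-stable totally isotropic subspace of
dimension `deg U`, and it equals the image of `(S·U*)(g)` where `S = f_g/(U·U*)`. -/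
theorem stmt10 {F V : Type*} [Field F] [Fintype F] (hodd : Odd (Fintype.card F))
    [AddCommGroup V] [Module F V] [FiniteDimensional F V]
    (B : LinearMap.BilinForm F V) (hsymm : ∀ x y : V, B x y = B y x)
    (hnd : B.Nondegenerate)
    (g : V ≃ₗ[F] V) (hg : ∀ x y : V, B (g x) (g y) = B x y)
    (fg : Polynomial F) (hfg : fg = LinearMap.charpoly (g : Module.End F V))
    (hcyc : minpoly F (g : Module.End F V) = fg)
    (U : Polynomial F) (hU : U.Monic) (hdvd : U * recip U ∣ fg)
    (K : Submodule F V)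
    (hK : K = LinearMap.ker (Polynomial.aeval (g : Module.End F V) U))
    (S : Polynomial F) (hS : S = fg / (U * recip U)) :
    (∀ x ∈ K, (g : Module.End F V) x ∈ K) ∧
    (∀ x ∈ K, ∀ y ∈ K, B x y = 0) ∧
    Module.finrank F K = U.natDegree ∧
    K = LinearMap.range (Polynomial.aeval (g : Module.End F V) (S * recip U)) := by
  obtain ⟨T, hT⟩ := hdvd
  have hf0 : fg ≠ 0 := hcyc ▸ minpoly.ne_zero (Algebra.IsIntegral.isIntegral _)
  have h0 : U * recip U ≠ 0 := by
    intro h; rw [h, zero_mul] at hT; exact hf0 hT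
  have hST : S = T := by
    rw [hS, hT]; exact mul_div_cancel_left₀ T h0
  subst hST
  have hfac : fg = U * (S * recip U) := by rw [hT]; ring
  obtain ⟨hdim, hker⟩ := aux_ker (g : Module.End F V) fg U (S * recip U) hcyc hfg hfac
  have hcomm : ∀ (p q : Polynomial F) (v : V),
      Polynomial.aeval (g : Module.End F V) p (Polynomial.aeval (g : Module.End F V) q v) =
      Polynomial.aeval (g : Module.End F V) q (Polynomial.aeval (g : Module.End F V) p v) := by
    intro p q v
    rw [← Module.End.mul_apply, ← Module.End.mul_apply, ← map_mul, ← map_mul, mul_comm]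
  subst hK
  refine ⟨?_, ?_, hdim, hker⟩
  · intro x hx
    rw [LinearMap.mem_ker] at hx ⊢
    have := hcomm U Polynomial.X x
    rw [hx, map_zero, Polynomial.aeval_X] at this
    exact this
  · intro x hx y hy
    rw [hker] at hx
    obtain ⟨v, rfl⟩ := hx
    have hbij : Function.Injective ((g : Module.End F V) ^ U.natDegree) := by
      rw [Module.End.coe_pow]
      exact Function.Injective.iterate g.injective _
    obtain ⟨y', rfl⟩ := LinearMap.surjective_of_injective hbij y
    rw [LinearMap.mem_ker] at hy
    have h1 := hcomm U (Polynomial.X ^ U.natDegree) y'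
    rw [map_pow, Polynomial.aeval_X, hy] at h1
    have hy' : Polynomial.aeval (g : Module.End F V) U y' = 0 := hbij (by rw [← h1, map_zero])
    rw [mul_comm S, recip, mul_assoc, map_mul, map_mul, Polynomial.aeval_C, Module.End.mul_apply,
      Module.algebraMap_end_apply, Module.End.mul_apply, map_smul, LinearMap.smul_apply,
      Polynomial.reverse, aux_adj B (g : Module.End F V) hg _ _ _ _ le_rfl, hy', map_zero, smul_zero]
end

section
/- Fix an odd prime power q and let σ be the q-power Frobenius of F_{q²}. Let V be a finite-dimensional F_{q²}-vector space with a nondegenerate Hermitian form B (additive in both variables, F_{q²}-linear in the first variable, σ-semilinear in the second, with B(y, x) = B(x, y)^q), and let g be a unitary automorphism of (V, B) whose minimal polynomial equals its characteristic polynomial f_g ∈ F_{q²}[λ]. Then for every d ≥ 0, the map W ↦ (characteristic polynomial of g restricted to W) is a bijection from the set of d-dimensional g-stable totally isotropic F_{q²}-subspaces W ⊆ V onto the set of monic polynomials U ∈ F_{q²}[λ] of degree d such that U·U* divides f_g in F_{q²}[λ]; the inverse map sends U to ker U(g). -/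
/-- The polynomial obtained by applying `x ↦ x^q` to the coefficients of `f`. -/
noncomputable def frobPoly {F : Type*} [Semiring F] (q : ℕ) (f : Polynomial F) :
    Polynomial F :=
  f.sum fun n a => Polynomial.C (a ^ q) * Polynomial.X ^ n

/-- The reciprocal polynomial `f*(λ) = (f(0)^σ)⁻¹ · λ^(deg f) · f^σ(1/λ)` of a
polynomial over `F_{q²}`, where `σ : x ↦ x^q` is the `q`-power Frobenius. -/
noncomputable def recip2 {F : Type*} [Field F] (q : ℕ) (f : Polynomial F) : Polynomial F :=
  Polynomial.C ((f.coeff 0 ^ q)⁻¹) * (frobPoly q f).reverse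

namespace Stmt12Aux
open Polynomial

lemma frobPoly_eq {F : Type*} [Field F] (q : ℕ) (s : F →+* F) (hs : ∀ a, s a = a ^ q)
    (f : F[X]) : frobPoly q f = f.map s := by
  unfold frobPoly
  rw [Polynomial.map, eval₂_eq_sum]
  simp [hs]

lemma revmap_revmap {F : Type*} [Field F] (s : F →+* F) (hs : ∀ a, s (s a) = a)
    (f : F[X]) (h0 : f.coeff 0 ≠ 0) :
    (((f.map s).reverse).map s).reverse = f := by
  have h1 : (f.map s).reverse.natDegree = f.natDegree := by
    have : (f.map s).natTrailingDegree = 0 := by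
      rw [natTrailingDegree_eq_zero]
      right
      simpa using h0
    rw [reverse_natDegree, this, natDegree_map]
    simp
  have h2 : (((f.map s).reverse).map s).natDegree = f.natDegree := by
    rw [natDegree_map, h1]
  rw [reverse, h2, reflect_map]
  rw [reverse, natDegree_map, reflect_reflect]
  ext n
  simp [hs]

section lin
variable {F V : Type*} [Field F] [AddCommGroup V] [Module F V]

lemma aeval_restrict (g : Module.End F V) (W : Submodule F V)
    (hW : ∀ x ∈ W, g x ∈ W) (P : F[X]) (x : W) :
    ((aeval (LinearMap.restrict g hW) P x : W) : V) = aeval g P (x : V) := by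
  induction P using Polynomial.induction_on generalizing x with
  | C a => simp
  | add p q hp hq => simp [hp, hq]
  | monomial n a h =>
    rw [pow_succ, ← mul_assoc]
    rw [map_mul (aeval (LinearMap.restrict g hW)) (C a * X ^ n), map_mul (aeval g) (C a * X ^ n),
      Module.End.mul_apply, Module.End.mul_apply, h]
    simp

lemma aeval_mem (g : Module.End F V) (W : Submodule F V)
    (hW : ∀ x ∈ W, g x ∈ W) (P : F[X]) (x : V) (hx : x ∈ W) : aeval g P x ∈ W := by
  rw [← aeval_restrict g W hW P ⟨x, hx⟩]
  exact Subtype.property _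

lemma aeval_comm (g : Module.End F V) (P Q : F[X]) (x : V) :
    aeval g P (aeval g Q x) = aeval g Q (aeval g P x) := by
  rw [← Module.End.mul_apply, ← Module.End.mul_apply, ← map_mul, ← map_mul, mul_comm]

variable [FiniteDimensional F V]

lemma degree_le_of_dvd (g : Module.End F V) (W : Submodule F V)
    (hW : ∀ x ∈ W, g x ∈ W) (U : F[X])
    (h : ∀ P : F[X], (∀ x ∈ W, aeval g P x = 0) → U ∣ P) :
    U ∣ minpoly F (LinearMap.restrict g hW) ∧ U.natDegree ≤ Module.finrank F W := by
  have h1 : U ∣ minpoly F (LinearMap.restrict g hW) := by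
    apply h
    intro x hx
    rw [← aeval_restrict g W hW _ ⟨x, hx⟩, minpoly.aeval]
    simp
  refine ⟨h1, ?_⟩
  rw [← LinearMap.charpoly_natDegree (LinearMap.restrict g hW)]
  exact natDegree_le_of_dvd (h1.trans (LinearMap.minpoly_dvd_charpoly _))
    (LinearMap.charpoly_monic _).ne_zero

lemma ker_stable (g : Module.End F V) (U : F[X]) :
    ∀ x ∈ LinearMap.ker (aeval g U), g x ∈ LinearMap.ker (aeval g U) := by
  intro x hx
  rw [LinearMap.mem_ker] at hx ⊢
  have := aeval_comm g U X x
  rw [aeval_X] at this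
  rw [this, hx, map_zero]

lemma range_stable (g : Module.End F V) (U : F[X]) :
    ∀ x ∈ LinearMap.range (aeval g U), g x ∈ LinearMap.range (aeval g U) := by
  rintro _ ⟨x, rfl⟩
  have := aeval_comm g X U x
  rw [aeval_X] at this
  rw [this]
  exact ⟨_, rfl⟩

lemma dvd_of_kill_range (g : Module.End F V) (U T : F[X]) (hU : U ≠ 0)
    (hf : minpoly F g = U * T) (P : F[X])
    (h : ∀ x ∈ LinearMap.range (aeval g U), aeval g P x = 0) : T ∣ P := by
  have : minpoly F g ∣ U * P := by
    apply minpoly.dvd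
    ext x
    rw [mul_comm, map_mul, Module.End.mul_apply, h _ ⟨x, rfl⟩]
    rfl
  rw [hf] at this
  exact (mul_dvd_mul_iff_left hU).1 this

lemma range_le_ker (g : Module.End F V) (U T : F[X])
    (hf : minpoly F g = U * T) :
    LinearMap.range (aeval g T) ≤ LinearMap.ker (aeval g U) := by
  rintro _ ⟨x, rfl⟩
  rw [LinearMap.mem_ker, ← Module.End.mul_apply, ← map_mul, ← hf, minpoly.aeval]
  rfl

lemma dvd_of_kill_ker (g : Module.End F V) (U T : F[X]) (hT : T ≠ 0)
    (hf : minpoly F g = U * T) (P : F[X])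
    (h : ∀ x ∈ LinearMap.ker (aeval g U), aeval g P x = 0) : U ∣ P :=
  dvd_of_kill_range g T U hT (by rw [hf, mul_comm]) P
    (fun x hx => h x (range_le_ker g U T hf hx))

lemma finrank_ker (g : Module.End F V) (U T : F[X])
    (hf : minpoly F g = U * T) (hc : minpoly F g = g.charpoly) :
    Module.finrank F (LinearMap.ker (aeval g U)) = U.natDegree := by
  have h0 : U * T ≠ 0 := by rw [← hf, hc]; exact (LinearMap.charpoly_monic _).ne_zero
  have hU := left_ne_zero_of_mul h0
  have hT := right_ne_zero_of_mul h0
  have h1 := (degree_le_of_dvd g _ (ker_stable g U) U (dvd_of_kill_ker g U T hT hf)).2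
  have h2 := (degree_le_of_dvd g _ (range_stable g U) T (dvd_of_kill_range g U T hU hf)).2
  have h3 := LinearMap.finrank_range_add_finrank_ker (aeval g U)
  have h4 := LinearMap.charpoly_natDegree g
  rw [← hc, hf, natDegree_mul hU hT] at h4
  omega

lemma range_eq_ker (g : Module.End F V) (U T : F[X])
    (hf : minpoly F g = U * T) (hc : minpoly F g = g.charpoly) :
    LinearMap.range (aeval g T) = LinearMap.ker (aeval g U) := by
  have h0 : U * T ≠ 0 := by rw [← hf, hc]; exact (LinearMap.charpoly_monic _).ne_zero
  have hU := left_ne_zero_of_mul h0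
  have hT := right_ne_zero_of_mul h0
  apply Submodule.eq_of_le_of_finrank_eq (range_le_ker g U T hf)
  have h1 := finrank_ker g U T hf hc
  have h2 := finrank_ker g T U (by rw [hf, mul_comm]) hc
  have h3 := LinearMap.finrank_range_add_finrank_ker (aeval g T)
  have h4 := LinearMap.charpoly_natDegree g
  rw [← hc, hf, natDegree_mul hU hT] at h4
  omega

lemma charpoly_ker (g : Module.End F V) (U T : F[X]) (hm : U.Monic)
    (hf : minpoly F g = U * T) (hc : minpoly F g = g.charpoly)
    (hK : ∀ x ∈ LinearMap.ker (aeval g U), g x ∈ LinearMap.ker (aeval g U)) :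
    (LinearMap.restrict g hK).charpoly = U := by
  have h0 : U * T ≠ 0 := by rw [← hf, hc]; exact (LinearMap.charpoly_monic _).ne_zero
  have hT := right_ne_zero_of_mul h0
  have h1 := (degree_le_of_dvd g _ hK U (dvd_of_kill_ker g U T hT hf)).1
  refine eq_of_monic_of_dvd_of_natDegree_le hm (LinearMap.charpoly_monic _)
    (h1.trans (LinearMap.minpoly_dvd_charpoly _)) ?_
  rw [LinearMap.charpoly_natDegree, finrank_ker g U T hf hc]

lemma stable_eq_ker (g : Module.End F V) (hc : minpoly F g = g.charpoly)
    (W : Submodule F V) (hW : ∀ x ∈ W, g x ∈ W) :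
    (LinearMap.restrict g hW).charpoly ∣ minpoly F g ∧
    LinearMap.ker (aeval g (LinearMap.restrict g hW).charpoly) = W := by
  set m := minpoly F (LinearMap.restrict g hW) with hm
  have hmd : m ∣ minpoly F g := by
    apply minpoly.dvd
    ext x
    rw [aeval_restrict, minpoly.aeval]
    simp
  have hmc : m ∣ _ := LinearMap.minpoly_dvd_charpoly (LinearMap.restrict g hW)
  have hle : W ≤ LinearMap.ker (aeval g m) := by
    intro x hx
    rw [LinearMap.mem_ker, ← aeval_restrict g W hW m ⟨x, hx⟩, hm, minpoly.aeval]
    simp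
  obtain ⟨T, hT⟩ := hmd
  have hk := finrank_ker g m T hT hc
  have h1 := Submodule.finrank_mono hle
  have h2 := LinearMap.charpoly_natDegree (LinearMap.restrict g hW)
  have h3 : m = (LinearMap.restrict g hW).charpoly :=
    (eq_of_monic_of_dvd_of_natDegree_le
      (minpoly.monic (Algebra.IsIntegral.isIntegral _)) (LinearMap.charpoly_monic _) hmc
      (by rw [← hm, h2]; omega)).symm
  rw [← h3]
  refine ⟨⟨T, hT⟩, (Submodule.eq_of_le_of_finrank_le hle ?_).symm⟩
  have := natDegree_le_of_dvd hmc (LinearMap.charpoly_monic _).ne_zero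
  omega

end lin

lemma adj {F V : Type*} [Field F] [AddCommGroup V] [Module F V] (q : ℕ) (s : F →+* F)
    (hs : ∀ a, s a = a ^ q) (hss : ∀ a, s (s a) = a) (B : V → V → F)
    (hadd1 : ∀ x y z : V, B (x + y) z = B x z + B y z)
    (hadd2 : ∀ x y z : V, B x (y + z) = B x y + B x z)
    (hsmul1 : ∀ (c : F) (x y : V), B (c • x) y = c * B x y)
    (hsmul2 : ∀ (c : F) (x y : V), B x (c • y) = c ^ q * B x y)
    (g : Module.End F V) (hg : ∀ x y : V, B (g x) (g y) = B x y) (P : F[X]) (x y : V) :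
    B (aeval g P x) ((g ^ P.natDegree) y) = B x (aeval g (P.map s).reverse y) := by
  have hpow : ∀ (n : ℕ) (x y : V), B ((g ^ n) x) ((g ^ n) y) = B x y := by
    intro n
    induction n with
    | zero => intro x y; rfl
    | succ n ih => intro x y; rw [pow_succ, Module.End.mul_apply, Module.End.mul_apply, ih, hg]
  have h01 : ∀ z, B 0 z = 0 := fun z => by simpa using hsmul1 0 0 z
  have h02 : ∀ z, B z 0 = 0 := fun z => by simpa using hadd2 z 0 0
  rw [reverse, natDegree_map]
  generalize hN : P.natDegree = N
  refine induction_with_natDegree_le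
    (fun P => B (aeval g P x) ((g ^ N) y) = B x (aeval g (reflect N (P.map s)) y))
    N ?_ ?_ ?_ P hN.le
  · simp [h01, h02]
  · intro n r _ hn
    simp only [Polynomial.map_mul, map_C, Polynomial.map_pow, map_X, reflect_C_mul_X_pow,
      revAt_le hn, map_mul, map_pow, aeval_X, aeval_C, Module.End.mul_apply,
      Module.algebraMap_end_apply, hsmul1, hsmul2]
    rw [← hs, hss]
    congr 1
    conv_lhs => rw [← Nat.add_sub_cancel' hn, pow_add, Module.End.mul_apply, hpow]
  · intro f h _ _ h1 h2
    simp only [Polynomial.map_add, reflect_add, map_add, LinearMap.add_apply, hadd1, hadd2, h1, h2]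

end Stmt12Aux

/-- Let `V` be a finite-dimensional space over `F_{q²}` (`q`
an odd prime power) with a nondegenerate Hermitian form `B` (linear in the first
variable, `σ`-semilinear in the second, `B(y,x) = B(x,y)^q`), and let `g` be a
unitary automorphism whose minimal polynomial equals its characteristic
polynomial `f_g`.  Then for every `d ≥ 0`, the map `W ↦ charpoly (g|_W)` is a
bijection from the `d`-dimensional `g`-stable totally isotropic subspaces of `V`
onto the monic `U` of degree `d` with `U·U* ∣ f_g`; its inverse sends `U` to
`ker U(g)`. -/
theorem stmt12 (q : ℕ) (hq : ∃ p n : ℕ, p.Prime ∧ 0 < n ∧ q = p ^ n) (hodd : Odd q)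
    {F V : Type*} [Field F] [Fintype F] (hcard : Fintype.card F = q ^ 2)
    [AddCommGroup V] [Module F V] [FiniteDimensional F V]
    (B : V → V → F)
    (hadd1 : ∀ x y z : V, B (x + y) z = B x z + B y z)
    (hadd2 : ∀ x y z : V, B x (y + z) = B x y + B x z)
    (hsmul1 : ∀ (c : F) (x y : V), B (c • x) y = c * B x y)
    (hsmul2 : ∀ (c : F) (x y : V), B x (c • y) = c ^ q * B x y)
    (hconj : ∀ x y : V, B y x = (B x y) ^ q)
    (hnd : ∀ x : V, (∀ y : V, B x y = 0) → x = 0)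
    (g : V ≃ₗ[F] V) (hg : ∀ x y : V, B (g x) (g y) = B x y)
    (fg : Polynomial F) (hfg : fg = LinearMap.charpoly (g : Module.End F V))
    (hcyc : minpoly F (g : Module.End F V) = fg)
    (d : ℕ) :
    (∀ (W : Submodule F V) (hW : ∀ x ∈ W, (g : Module.End F V) x ∈ W),
      (∀ x ∈ W, ∀ y ∈ W, B x y = 0) → Module.finrank F W = d →
      (LinearMap.charpoly (LinearMap.restrict (g : Module.End F V) hW)).Monic ∧
      (LinearMap.charpoly (LinearMap.restrict (g : Module.End F V) hW)).natDegree = d ∧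
      LinearMap.charpoly (LinearMap.restrict (g : Module.End F V) hW) *
          recip2 q (LinearMap.charpoly (LinearMap.restrict (g : Module.End F V) hW)) ∣ fg ∧
      LinearMap.ker (Polynomial.aeval (g : Module.End F V)
          (LinearMap.charpoly (LinearMap.restrict (g : Module.End F V) hW))) = W) ∧
    (∀ U : Polynomial F, U.Monic → U.natDegree = d → U * recip2 q U ∣ fg →
      (∀ x ∈ LinearMap.ker (Polynomial.aeval (g : Module.End F V) U),
        (g : Module.End F V) x ∈ LinearMap.ker (Polynomial.aeval (g : Module.End F V) U)) ∧
      (∀ x ∈ LinearMap.ker (Polynomial.aeval (g : Module.End F V) U),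
        ∀ y ∈ LinearMap.ker (Polynomial.aeval (g : Module.End F V) U), B x y = 0) ∧
      Module.finrank F (LinearMap.ker (Polynomial.aeval (g : Module.End F V) U)) = d ∧
      ∀ hK : ∀ x ∈ LinearMap.ker (Polynomial.aeval (g : Module.End F V) U),
          (g : Module.End F V) x ∈ LinearMap.ker (Polynomial.aeval (g : Module.End F V) U),
        LinearMap.charpoly (LinearMap.restrict (g : Module.End F V) hK) = U) := by
  classical
  obtain ⟨p, n, hp, hn, rfl⟩ := hq
  have : Fact p.Prime := ⟨hp⟩
  have : CharP F p := charP_of_card_eq_prime_pow (f := n * 2) (by rw [hcard, ← pow_mul])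
  set s : F →+* F := iterateFrobenius F p n with hsdef
  have hs : ∀ a, s a = a ^ p ^ n := fun a => iterateFrobenius_def ..
  have hss : ∀ a, s (s a) = a := by
    intro a
    rw [hs, hs, ← pow_mul, ← sq, ← hcard, FiniteField.pow_card]
  have hc : minpoly F (g : Module.End F V) = (g : Module.End F V).charpoly := by rw [hcyc, hfg]
  have hf0 : fg.coeff 0 ≠ 0 := by
    have h1 := LinearMap.det_eq_sign_charpoly_coeff (g : Module.End F V)
    rw [← hfg] at h1
    intro h
    rw [h, mul_zero] at h1
    exact (LinearEquiv.isUnit_det' g).ne_zero h1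
  have hz : ∀ U T : Polynomial F, fg = U * T → U.coeff 0 ≠ 0 ∧ T.coeff 0 ≠ 0 := by
    intro U T h
    rw [h, Polynomial.mul_coeff_zero] at hf0
    exact ⟨left_ne_zero_of_mul hf0, right_ne_zero_of_mul hf0⟩
  have hadj := Stmt12Aux.adj (p ^ n) s hs hss B hadd1 hadd2 hsmul1 hsmul2 (g : Module.End F V) hg
  have h01 : ∀ z, B 0 z = 0 := fun z => by simpa using hsmul1 0 0 z
  have hrec : ∀ U : Polynomial F, recip2 (p ^ n) U =
      Polynomial.C ((U.coeff 0 ^ p ^ n)⁻¹) * (U.map s).reverse := by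
    intro U
    rw [recip2, Stmt12Aux.frobPoly_eq _ s hs]
  constructor
  · intro W hW hiso hd
    obtain ⟨hdvd, hker⟩ := Stmt12Aux.stable_eq_ker (g : Module.End F V) hc W hW
    set U := LinearMap.charpoly (LinearMap.restrict (g : Module.End F V) hW) with hU
    refine ⟨LinearMap.charpoly_monic _, by rw [hU, LinearMap.charpoly_natDegree, hd], ?_, hker⟩
    obtain ⟨T, hT⟩ := hdvd
    obtain ⟨hU0, hT0⟩ := hz U T (by rw [← hcyc, hT])
    have hTne : T ≠ 0 := by rintro rfl; simp at hT0
    have hkey : U ∣ (T.map s).reverse := by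
      apply Stmt12Aux.dvd_of_kill_ker (g : Module.End F V) U T hTne hT
      intro y hy
      apply hnd
      intro x
      rw [hconj x, ← hadj, hiso, zero_pow (pow_pos hp.pos n).ne']
      · rw [← hker]
        exact Stmt12Aux.range_le_ker _ U T hT ⟨x, rfl⟩
      · rw [hker] at hy
        have := Stmt12Aux.aeval_mem _ W hW (Polynomial.X ^ T.natDegree) y hy
        simpa using this
    obtain ⟨S, hS⟩ := hkey
    have hTT := Stmt12Aux.revmap_revmap s hss T hT0
    rw [hS, Polynomial.map_mul, Polynomial.reverse_mul_of_domain] at hTT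
    rw [← hcyc, hT]
    apply mul_dvd_mul_left
    rw [hrec, ← hTT]
    have hu : IsUnit (Polynomial.C ((U.coeff 0 ^ p ^ n)⁻¹)) :=
      Polynomial.isUnit_C.2 (inv_ne_zero (pow_ne_zero _ hU0)).isUnit
    exact (hu.mul_left_dvd).2 (dvd_mul_right _ _)
  · intro U hm hd hdvd
    obtain ⟨S, hS⟩ := hdvd
    rw [hrec] at hS
    set T := (U.map s).reverse * (Polynomial.C ((U.coeff 0 ^ p ^ n)⁻¹) * S) with hTdef
    have hT : minpoly F (g : Module.End F V) = U * T := by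
      rw [hcyc, hS, hTdef]; ring
    refine ⟨Stmt12Aux.ker_stable _ U, ?_, ?_, ?_⟩
    · intro x hx y hy
      rw [← Stmt12Aux.range_eq_ker _ U T hT hc] at hy
      obtain ⟨z, rfl⟩ := hy
      rw [hTdef, map_mul, Module.End.mul_apply, ← hadj, LinearMap.mem_ker.1 hx, h01]
    · rw [Stmt12Aux.finrank_ker _ U T hT hc, hd]
    · intro hK
      exact Stmt12Aux.charpoly_ker _ U T hm hT hc hK
end

section
/- Fix an odd prime power q. Let V be a finite-dimensional F_q-vector space of even dimension 2n with a nondegenerate symmetric bilinear form B, and let g be an isometry of (V, B) with det g = 1 whose minimal polynomial equals its characteristic polynomial f_g ∈ F_q[λ]. Then (λ + 1) does not divide f_g, and the multiplicity of (λ − 1) in f_g is either zero or odd. -/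
lemma aux_det_neg {F W : Type*} [Field F] [AddCommGroup W] [Module F W] [FiniteDimensional F W]
    (Φ : LinearMap.BilinForm F W) (G : W →ₗ[F] W) (hsep : LinearMap.SeparatingLeft Φ)
    (h : ∀ x y, Φ y (G x) = - Φ x y) :
    LinearMap.det G = (-1) ^ (Module.finrank F W) := by
  classical
  let b := Module.finBasis F W
  have hM : (LinearMap.BilinForm.toMatrix b Φ).det ≠ 0 :=
    (LinearMap.BilinForm.nondegenerate_iff_det_ne_zero b).1
      (LinearMap.BilinForm.Nondegenerate.ofSeparatingLeft hsep)
  have e : LinearMap.BilinForm.toMatrix b Φ * LinearMap.toMatrix b b G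
      = - (LinearMap.BilinForm.toMatrix b Φ).transpose := by
    rw [← LinearMap.BilinForm.toMatrix_compRight]
    ext i j
    simp [LinearMap.BilinForm.toMatrix_apply, h]
  have e2 := congrArg Matrix.det e
  rw [Matrix.det_mul, Matrix.det_neg, Matrix.det_transpose, LinearMap.det_toMatrix,
    Fintype.card_fin, mul_comm] at e2
  exact mul_right_cancel₀ hM e2

lemma aux_even {F V : Type*} [Field F] [AddCommGroup V] [Module F V] [FiniteDimensional F V]
    (h2 : (-1 : F) ≠ 1) (hdim : Even (Module.finrank F V))
    (B : LinearMap.BilinForm F V) (hsymm : ∀ x y : V, B x y = B y x)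
    (hnd : B.Nondegenerate)
    (g : V →ₗ[F] V) (hg : ∀ x y : V, B (g x) (g y) = B x y)
    (hdet : LinearMap.det g = 1) :
    Even (Module.finrank F (LinearMap.ker (g - 1))) := by
  set K := LinearMap.ker (g - 1) with hK
  have hmem : ∀ x, x ∈ K ↔ g x = x := by
    intro x
    simp [hK, sub_eq_zero]
  let φ : LinearMap.BilinForm F V := LinearMap.BilinForm.compLeft B (1 - g)
  have hφ : ∀ x y, φ x y = B x y - B (g x) y := by
    intro x y
    simp [φ]
  have hφg : ∀ x y, φ y (g x) = - φ x y := by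
    intro x y
    rw [hφ, hφ, hg, hsymm y (g x), hsymm y x]
    ring
  have hinv : K ≤ K.comap g := by
    intro x hx
    rw [Submodule.mem_comap, (hmem x).1 hx]
    exact hx
  have h1 : K ≤ LinearMap.ker φ := by
    intro x hx
    rw [LinearMap.mem_ker]
    ext y
    rw [hφ, (hmem x).1 hx]
    simp
  let φ1 := K.liftQ φ h1
  have h2' : K ≤ LinearMap.ker φ1.flip := by
    intro y hy
    rw [LinearMap.mem_ker]
    ext x
    change φ x y = 0
    have := hφg x y
    rw [LinearMap.mem_ker.1 (h1 hy)] at this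
    simpa using this.symm
  let Φ : LinearMap.BilinForm F (V ⧸ K) := (K.liftQ φ1.flip h2').flip
  have hΦ : ∀ x y, Φ (K.mkQ x) (K.mkQ y) = φ x y := fun x y => rfl
  have hsep : LinearMap.SeparatingLeft Φ := by
    intro x hx
    obtain ⟨x, rfl⟩ := K.mkQ_surjective x
    have : x - g x = 0 := by
      apply hnd.1
      intro y
      have := hx (K.mkQ y)
      rw [hΦ, hφ] at this
      simpa using this
    rw [Submodule.mkQ_apply, Submodule.Quotient.mk_eq_zero, hmem]
    exact (sub_eq_zero.1 this).symm
  have hd := aux_det_neg Φ (K.mapQ K g hinv) hsep (by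
    intro x y
    obtain ⟨x, rfl⟩ := K.mkQ_surjective x
    obtain ⟨y, rfl⟩ := K.mkQ_surjective y
    exact hφg x y)
  have hr : g.restrict hinv = LinearMap.id := by
    ext x
    exact (hmem x).1 x.2
  have hd2 := LinearMap.det_eq_det_mul_det K g hinv
  rw [hr, LinearMap.det_id, one_mul, hdet, hd] at hd2
  have hev : Even (Module.finrank F (V ⧸ K)) := by
    by_contra hne
    rw [Nat.not_even_iff_odd] at hne
    rw [hne.neg_one_pow] at hd2
    exact h2 hd2.symm
  rw [← K.finrank_quotient_add_finrank, Nat.even_add] at hdim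
  exact hdim.1 hev

lemma aux_le_one {F V : Type*} [Field F] [AddCommGroup V] [Module F V] [FiniteDimensional F V]
    (g : Module.End F V) (hcyc : minpoly F g = LinearMap.charpoly g) (a : F) :
    Module.finrank F (LinearMap.ker (g - algebraMap F _ a)) ≤ 1 := by
  set h := g - algebraMap F (Module.End F V) a with hh
  have hcomm : Commute g h := by
    rw [hh]
    exact (Commute.refl g).sub_right (Algebra.commute_algebraMap_right a g)
  have hinv : ∀ x ∈ LinearMap.range h, g x ∈ LinearMap.range h := by
    rintro _ ⟨y, rfl⟩
    exact ⟨g y, (LinearMap.congr_fun hcomm.eq y).symm⟩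
  let r : Module.End F (LinearMap.range h) := g.restrict hinv
  have hr : ∀ (p : Polynomial F) (x : LinearMap.range h),
      ((Polynomial.aeval r p x : LinearMap.range h) : V) = Polynomial.aeval g p (x : V) := by
    intro p
    induction p using Polynomial.induction_on' with
    | add p q hp hq => intro x; simp [hp, hq]
    | monomial n c =>
      intro x
      have : ∀ n : ℕ, (((r ^ n) x : LinearMap.range h) : V) = (g ^ n) (x : V) := by
        intro n
        induction n with
        | zero => simp
        | succ n ih => rw [pow_succ', pow_succ', Module.End.mul_apply, Module.End.mul_apply, ← ih]; rfl
      simp [Polynomial.aeval_monomial, this]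
  have hdvd : minpoly F g ∣ r.charpoly * (Polynomial.X - Polynomial.C a) := by
    apply minpoly.dvd
    ext x
    have h0 := hr r.charpoly ⟨h x, x, rfl⟩
    rw [LinearMap.aeval_self_charpoly] at h0
    simpa [hh] using h0.symm
  have hdeg := Polynomial.natDegree_le_of_dvd hdvd
    (mul_ne_zero r.charpoly_monic.ne_zero (Polynomial.X_sub_C_ne_zero a))
  rw [hcyc, LinearMap.charpoly_natDegree, Polynomial.natDegree_mul r.charpoly_monic.ne_zero
    (Polynomial.X_sub_C_ne_zero a), LinearMap.charpoly_natDegree, Polynomial.natDegree_X_sub_C] at hdeg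
  have := LinearMap.finrank_range_add_finrank_ker h
  omega

lemma aux_not_root {F V : Type*} [Field F] [AddCommGroup V] [Module F V] [FiniteDimensional F V]
    (g : Module.End F V) (hcyc : minpoly F g = LinearMap.charpoly g) (a : F)
    (hev : Even (Module.finrank F (LinearMap.ker (g - algebraMap F _ a)))) :
    ¬ (LinearMap.charpoly g).IsRoot a := by
  have h1 := aux_le_one g hcyc a
  have h0 : Module.finrank F (LinearMap.ker (g - algebraMap F _ a)) = 0 := by
    obtain ⟨k, hk⟩ := hev
    omega
  rw [← Module.End.hasEigenvalue_iff_isRoot_charpoly, Module.End.hasEigenvalue_iff,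
    Module.End.eigenspace_def, not_not]
  exact Submodule.finrank_eq_zero.1 h0

/-- Let `V` be a `2n`-dimensional space over `F_q` (`q` odd)
with a nondegenerate symmetric bilinear form `B`, and let `g` be an isometry of
determinant `1` whose minimal polynomial equals its characteristic polynomial
`f_g`.  Then `(λ + 1)` does not divide `f_g`, and the multiplicity of `(λ - 1)`
in `f_g` is either zero or odd. -/
theorem stmt16 {F V : Type*} [Field F] [Fintype F] (hodd : Odd (Fintype.card F))
    [AddCommGroup V] [Module F V] [FiniteDimensional F V]
    (n : ℕ) (hdim : Module.finrank F V = 2 * n)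
    (B : LinearMap.BilinForm F V) (hsymm : ∀ x y : V, B x y = B y x)
    (hnd : B.Nondegenerate)
    (g : V ≃ₗ[F] V) (hg : ∀ x y : V, B (g x) (g y) = B x y)
    (hdet : LinearMap.det (g : V →ₗ[F] V) = 1)
    (fg : Polynomial F) (hfg : fg = LinearMap.charpoly (g : Module.End F V))
    (hcyc : minpoly F (g : Module.End F V) = fg) :
    ¬ (Polynomial.X + 1 ∣ fg) ∧
    (fg.rootMultiplicity 1 = 0 ∨ Odd (fg.rootMultiplicity 1)) := by
  have h2 : (-1 : F) ≠ 1 := by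
    apply Ring.neg_one_ne_one_of_char_ne_two
    intro hc
    have := FiniteField.even_card_of_char_two hc
    rw [Nat.odd_iff] at hodd
    omega
  subst hfg
  have hE : Even (Module.finrank F V) := ⟨n, by omega⟩
  have e1 := aux_even h2 hE B hsymm hnd (g : V →ₗ[F] V) hg hdet
  have e2 := aux_even h2 hE B hsymm hnd (-(g : V →ₗ[F] V)) (by simpa using hg) (by
    rw [← neg_one_smul F (g : V →ₗ[F] V), LinearMap.det_smul, hdet, hE.neg_one_pow, one_mul])
  have r1 := aux_not_root (g : Module.End F V) hcyc 1 (by rw [map_one]; exact e1)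
  have r2 := aux_not_root (g : Module.End F V) hcyc (-1) (by
    have : (g : Module.End F V) - algebraMap F _ (-1) = -(-(g : V →ₗ[F] V) - 1) := by
      rw [map_neg, map_one]
      ext x
      simp [add_comm]
    rw [this, LinearMap.ker_neg]
    exact e2)
  refine ⟨fun hd => r2 ?_, Or.inl (Polynomial.rootMultiplicity_eq_zero r1)⟩
  rw [← Polynomial.dvd_iff_isRoot]
  simpa using hd
end
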